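/- Let G be a connected weighted partial 2-tree that is not outerplanar, let {u,v} be a vertex separator of G such that G − {u,v} has at least three components, let H be a component of G − {u,v} with V(lsp(u,v)) ∩ V(H) = ∅ and E(lsp(u,v)) ∩ E(H) = ∅, and let G₁, G₂ be obtained by decomp(G,u,v). Then for each i ∈ {1,2} and all vertices x, y on lsp(u,v), the lex shortest path lsp(x,y) of G is contained in G_i. -/

import Mathlib

/-!
Common definitions for formalizing "Minimum Cycle Basis in Weighted Partial 2-trees".
-/

namespace LexMCB

open SimpleGraph

variable {V : Type*}

/-- The weight of a walk: the sum of the weights of its edges. -/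
def walkWeight {G : SimpleGraph V} (w : Sym2 V → ℕ) {a b : V} (p : G.Walk a b) : ℕ :=
  (p.edges.map w).sum

/-- A walk is contained in the subgraph described by vertex set `V₁` and edge set `E₁`. -/
def WalkIn {G : SimpleGraph V} (V₁ : Set V) (E₁ : Set (Sym2 V)) {a b : V}
    (p : G.Walk a b) : Prop :=
  (∀ t ∈ p.support, t ∈ V₁) ∧ ∀ e ∈ p.edges, e ∈ E₁

/-- `p` is lexicographically better than `q`: either it has smaller weight, or equal weight
and fewer edges, or equal weight and equally many edges and
`min (V(q) \ V(p)) > min (V(p) \ V(q))`. -/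
def LexBetter [LinearOrder V] {G : SimpleGraph V} (w : Sym2 V → ℕ) {a b : V}
    (p q : G.Walk a b) : Prop :=
  walkWeight w p < walkWeight w q ∨
    (walkWeight w q = walkWeight w p ∧ p.length < q.length) ∨
    (walkWeight w q = walkWeight w p ∧ q.length = p.length ∧
      (p.support.toFinset \ q.support.toFinset).min <
        (q.support.toFinset \ p.support.toFinset).min)

/-- `p` is the lex shortest path between its endpoints among the paths lying in the
subgraph described by vertex set `V₁` and edge set `E₁`. -/
def IsLexShortestPathIn [LinearOrder V] {G : SimpleGraph V} (w : Sym2 V → ℕ)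
    (V₁ : Set V) (E₁ : Set (Sym2 V)) {a b : V} (p : G.Walk a b) : Prop :=
  p.IsPath ∧ WalkIn V₁ E₁ p ∧
    ∀ q : G.Walk a b, q.IsPath → WalkIn V₁ E₁ q → q ≠ p → LexBetter w p q

/-- `p` is the lex shortest path of `G` between its endpoints. -/
def IsLexShortestPath [LinearOrder V] {G : SimpleGraph V} (w : Sym2 V → ℕ)
    {a b : V} (p : G.Walk a b) : Prop :=
  IsLexShortestPathIn w Set.univ G.edgeSet p

/-- A (sub)graph is a cycle: it is connected and every vertex has degree two. -/
def IsCycleSubgraph {G : SimpleGraph V} (C : G.Subgraph) : Prop :=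
  C.Connected ∧ ∀ t ∈ C.verts, (C.neighborSet t).ncard = 2

/-- `C` is a lex short cycle of the subgraph of `G` described by vertex set `V₁` and
edge set `E₁`: it is a cycle lying there, and for any two distinct vertices `x,y` of `C`
the lex shortest `x`-`y` path of that subgraph is contained in `C`. -/
def IsLexShortCycleIn [LinearOrder V] {G : SimpleGraph V} (w : Sym2 V → ℕ)
    (V₁ : Set V) (E₁ : Set (Sym2 V)) (C : G.Subgraph) : Prop :=
  C.verts ⊆ V₁ ∧ C.edgeSet ⊆ E₁ ∧ IsCycleSubgraph C ∧
    ∀ x ∈ C.verts, ∀ y ∈ C.verts, x ≠ y →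
      ∀ p : G.Walk x y, IsLexShortestPathIn w V₁ E₁ p → ∀ e ∈ p.edges, e ∈ C.edgeSet

/-- The set of lex short cycles of the subgraph of `G` described by `V₁`, `E₁`. -/
def LSCIn [LinearOrder V] (G : SimpleGraph V) (w : Sym2 V → ℕ)
    (V₁ : Set V) (E₁ : Set (Sym2 V)) : Set G.Subgraph :=
  {C | IsLexShortCycleIn w V₁ E₁ C}

/-- The set of lex short cycles of `G`. -/
def LSC [LinearOrder V] (G : SimpleGraph V) (w : Sym2 V → ℕ) : Set G.Subgraph :=
  LSCIn G w Set.univ G.edgeSet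

/-! ### Components and separators -/

/-- The edges of `G` lying within the vertex set `H`. -/
def edgesWithin (G : SimpleGraph V) (H : Set V) : Set (Sym2 V) :=
  {e | e ∈ G.edgeSet ∧ ∀ t ∈ e, t ∈ H}

/-- `H` is (the vertex set of) a connected component of the induced subgraph `G[A]`:
it is a maximal subset of `A` inducing a connected subgraph. -/
def IsComponentOf (G : SimpleGraph V) (A : Set V) (H : Set V) : Prop :=
  H.Nonempty ∧ H ⊆ A ∧ (G.induce H).Connected ∧
    ∀ K : Set V, H ⊆ K → K ⊆ A → (G.induce K).Connected → K = H

/-- `{u, v}` is a vertex separator of `G` : deleting `u` and `v` disconnects `G`. -/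
def IsSeparatorPair (G : SimpleGraph V) (u v : V) : Prop :=
  ¬ (G.induce {t | t ≠ u ∧ t ≠ v}).Connected

/-- The number of connected components of `G - {u, v}`. -/
noncomputable def numComponentsDel (G : SimpleGraph V) (u v : V) : ℕ :=
  Nat.card ((G.induce {t | t ≠ u ∧ t ≠ v}).ConnectedComponent)

/-! ### Subdivisions of `K₄` and `K_{2,3}`, outerplanarity -/

/-- The interior (internal vertices) of a walk. -/
def walkInterior {G : SimpleGraph V} {a b : V} (p : G.Walk a b) : Set V :=
  {t | t ∈ p.support} \ {a, b}

/-- A `K_{2,3}`-subdivision in `G` with branch vertices `u, v` (the side of size two)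
and `x, y, z` (the side of size three): six internally disjoint paths joining each of
`u, v` to each of `x, y, z`, whose interiors avoid the branch vertices. -/
structure K23Subdiv (G : SimpleGraph V) (u v x y z : V) where
  pux : G.Walk u x
  puy : G.Walk u y
  puz : G.Walk u z
  pvx : G.Walk v x
  pvy : G.Walk v y
  pvz : G.Walk v z
  branch_nodup : List.Pairwise (· ≠ ·) [u, v, x, y, z]
  isPath_pux : pux.IsPath
  isPath_puy : puy.IsPath
  isPath_puz : puz.IsPath
  isPath_pvx : pvx.IsPath
  isPath_pvy : pvy.IsPath
  isPath_pvz : pvz.IsPath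
  interiors_disjoint : List.Pairwise Disjoint
    [walkInterior pux, walkInterior puy, walkInterior puz,
     walkInterior pvx, walkInterior pvy, walkInterior pvz]
  interiors_avoid_branch : ∀ s ∈ [walkInterior pux, walkInterior puy, walkInterior puz,
      walkInterior pvx, walkInterior pvy, walkInterior pvz],
    ∀ t ∈ s, t ∉ ({u, v, x, y, z} : Set V)

/-- The vertex set of a `K_{2,3}`-subdivision. -/
def K23Subdiv.vertSet {G : SimpleGraph V} {u v x y z : V} (K : K23Subdiv G u v x y z) :
    Set V :=
  {t | t ∈ K.pux.support ∨ t ∈ K.puy.support ∨ t ∈ K.puz.support ∨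
       t ∈ K.pvx.support ∨ t ∈ K.pvy.support ∨ t ∈ K.pvz.support}

/-- The edge set of a `K_{2,3}`-subdivision. -/
def K23Subdiv.edges {G : SimpleGraph V} {u v x y z : V} (K : K23Subdiv G u v x y z) :
    Set (Sym2 V) :=
  {e | e ∈ K.pux.edges ∨ e ∈ K.puy.edges ∨ e ∈ K.puz.edges ∨
       e ∈ K.pvx.edges ∨ e ∈ K.pvy.edges ∨ e ∈ K.pvz.edges}

/-- `G` contains a subdivision of `K_{2,3}`. -/
def HasK23Subdivision (G : SimpleGraph V) : Prop :=
  ∃ u v x y z : V, Nonempty (K23Subdiv G u v x y z)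

/-- The subgraph `S` of `G` is (exactly) a `K_{2,3}`-subdivision. -/
def IsK23SubdivisionSubgraph {G : SimpleGraph V} (S : G.Subgraph) : Prop :=
  ∃ (u v x y z : V) (K : K23Subdiv G u v x y z),
    K.vertSet = S.verts ∧ K.edges = S.edgeSet

/-- A `K₄`-subdivision in `G` with branch vertices `a, b, c, d`. -/
structure K4Subdiv (G : SimpleGraph V) (a b c d : V) where
  pab : G.Walk a b
  pac : G.Walk a c
  pad : G.Walk a d
  pbc : G.Walk b c
  pbd : G.Walk b d
  pcd : G.Walk c d
  branch_nodup : List.Pairwise (· ≠ ·) [a, b, c, d]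
  isPath_pab : pab.IsPath
  isPath_pac : pac.IsPath
  isPath_pad : pad.IsPath
  isPath_pbc : pbc.IsPath
  isPath_pbd : pbd.IsPath
  isPath_pcd : pcd.IsPath
  interiors_disjoint : List.Pairwise Disjoint
    [walkInterior pab, walkInterior pac, walkInterior pad,
     walkInterior pbc, walkInterior pbd, walkInterior pcd]
  interiors_avoid_branch : ∀ s ∈ [walkInterior pab, walkInterior pac, walkInterior pad,
      walkInterior pbc, walkInterior pbd, walkInterior pcd],
    ∀ t ∈ s, t ∉ ({a, b, c, d} : Set V)

/-- `G` contains a subdivision of `K₄`. -/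
def HasK4Subdivision (G : SimpleGraph V) : Prop :=
  ∃ a b c d : V, Nonempty (K4Subdiv G a b c d)

/-- `G` is outerplanar.  (We use the classical combinatorial characterization:
a graph is outerplanar iff it has no subgraph that is a subdivision of `K₄` or of
`K_{2,3}`.) -/
def IsOuterplanar (G : SimpleGraph V) : Prop :=
  ¬ HasK4Subdivision G ∧ ¬ HasK23Subdivision G

/-! ### 2-trees and partial 2-trees -/

/-- Add to `G` a new vertex adjacent to (exactly) `a` and `b`. -/
def addVertexOnEdge {n : ℕ} (G : SimpleGraph (Fin n)) (a b : Fin n) :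
    SimpleGraph (Fin (n + 1)) :=
  SimpleGraph.fromRel fun i j =>
    (∃ i' j' : Fin n, i = Fin.castSucc i' ∧ j = Fin.castSucc j' ∧ G.Adj i' j') ∨
    (i = Fin.last n ∧ (j = Fin.castSucc a ∨ j = Fin.castSucc b))

/-- 2-trees, defined inductively: `K₃` is a 2-tree, and adding a new vertex whose
neighbourhood is an edge of a 2-tree again gives a 2-tree. -/
inductive IsTwoTree : ∀ {n : ℕ}, SimpleGraph (Fin n) → Prop
  | base : IsTwoTree (⊤ : SimpleGraph (Fin 3))
  | extend {n : ℕ} (G : SimpleGraph (Fin n)) (a b : Fin n) :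
      IsTwoTree G → G.Adj a b → IsTwoTree (addVertexOnEdge G a b)

/-- A partial 2-tree: a subgraph of a 2-tree. -/
def IsPartialTwoTree {W : Type*} (G : SimpleGraph W) : Prop :=
  ∃ (n : ℕ) (T : SimpleGraph (Fin n)) (f : W ↪ Fin n),
    IsTwoTree T ∧ ∀ x y : W, G.Adj x y → T.Adj (f x) (f y)

/-! ### The cycle space over `𝔽₂`, cycle bases and minimum cycle bases -/

/-- The incidence vector (over `𝔽₂`) of a subgraph, indexed by `Sym2 V`. -/
noncomputable def cycleIncVec {G : SimpleGraph V} (C : G.Subgraph) : Sym2 V → ZMod 2 :=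
  C.edgeSet.indicator fun _ => 1

/-- The cycle space of `G`: the span over `𝔽₂` of the incidence vectors of cycles. -/
def cycleSpace (G : SimpleGraph V) : Submodule (ZMod 2) (Sym2 V → ZMod 2) :=
  Submodule.span (ZMod 2) (cycleIncVec '' {C : G.Subgraph | IsCycleSubgraph C})

/-- `B` is a cycle basis of `G`: a minimum-cardinality set of cycles whose incidence
vectors span the cycle space of `G`. -/
def IsCycleBasis (G : SimpleGraph V) (B : Set G.Subgraph) : Prop :=
  (∀ C ∈ B, IsCycleSubgraph C) ∧
    Submodule.span (ZMod 2) (cycleIncVec '' B) = cycleSpace G ∧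
    ∀ B' : Set G.Subgraph, (∀ C ∈ B', IsCycleSubgraph C) →
      Submodule.span (ZMod 2) (cycleIncVec '' B') = cycleSpace G → B.ncard ≤ B'.ncard

/-- The weight of a cycle: the sum of the weights of its edges. -/
noncomputable def cycleWeight {G : SimpleGraph V} (w : Sym2 V → ℕ) (C : G.Subgraph) : ℕ :=
  ∑ᶠ e ∈ C.edgeSet, w e

/-- The total weight of a set of cycles. -/
noncomputable def basisWeight {G : SimpleGraph V} (w : Sym2 V → ℕ)
    (B : Set G.Subgraph) : ℕ :=
  ∑ᶠ C ∈ B, cycleWeight w C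

/-- `B` is a minimum cycle basis of `G`: a cycle basis of minimum total weight. -/
def IsMinimumCycleBasis (G : SimpleGraph V) (w : Sym2 V → ℕ) (B : Set G.Subgraph) : Prop :=
  IsCycleBasis G B ∧ ∀ B' : Set G.Subgraph, IsCycleBasis G B' →
    basisWeight w B ≤ basisWeight w B'

/-! ### The `decomp` operation -/

/-- The vertex set of the first part `G₁` of `decomp(G,u,v)`. -/
def decompVerts1 {G : SimpleGraph V} {u v : V} (P : G.Walk u v) (H : Set V) : Set V :=
  H ∪ {t | t ∈ P.support}

/-- The edge set of the first part `G₁` of `decomp(G,u,v)`: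
`E(H) ∪ E(lsp(u,v)) ∪ {(x,y) : x ∈ V(H), y ∈ {u,v}, (x,y) ∈ E(G)}`. -/
def decompEdges1 {G : SimpleGraph V} {u v : V} (P : G.Walk u v) (H : Set V) :
    Set (Sym2 V) :=
  edgesWithin G H ∪ {e | e ∈ P.edges} ∪
    {e | ∃ a ∈ H, ∃ c ∈ ({u, v} : Set V), G.Adj a c ∧ e = s(a, c)}


section LexShortest

variable {G : SimpleGraph V} (w : Sym2 V → ℕ)

theorem walkWeight_append {a b c : V} (p : G.Walk a b) (q : G.Walk b c) :
    walkWeight w (p.append q) = walkWeight w p + walkWeight w q := by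
  simp [walkWeight]

theorem walkWeight_reverse {a b : V} (p : G.Walk a b) :
    walkWeight w p.reverse = walkWeight w p := by
  simp [walkWeight, List.sum_reverse]

theorem walkWeight_bypass_le [DecidableEq V] {a b : V} (p : G.Walk a b) :
    walkWeight w p.bypass ≤ walkWeight w p :=
  (p.edges_bypass_sublist_edges.map w).sum_le_sum (by simp)

theorem walkIn_univ {a b : V} (p : G.Walk a b) : WalkIn Set.univ G.edgeSet p :=
  ⟨fun _ _ => trivial, fun _ he => p.edges_subset_edgeSet he⟩

/-- The middle part of a path meets the outer parts only in its endpoints. -/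
theorem eq_or_eq_of_isPath_append {u x y v : V} {A : G.Walk u x} {Q : G.Walk x y}
    {B : G.Walk y v} (h : ((A.append Q).append B).IsPath) {t : V} (ht : t ∈ Q.support)
    (ht' : t ∈ A.support ∨ t ∈ B.support) : t = x ∨ t = y := by
  have hAQ := h.of_append_left
  rw [Walk.isPath_def, Walk.support_append, List.nodup_append'] at h hAQ
  rcases ht' with hA | hB
  · rw [Walk.mem_support_iff] at ht
    exact ht.imp_right fun ht => (hAQ.2.2 hA ht).elim
  · rw [Walk.mem_support_iff] at hB
    exact .inr (hB.resolve_right fun hB => h.2.2 (by simp [ht]) hB)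

variable {w} [LinearOrder V]

theorem LexBetter.reverse {a b : V} {p q : G.Walk a b} (h : LexBetter w p q) :
    LexBetter w p.reverse q.reverse := by
  simpa [LexBetter, walkWeight_reverse] using h

theorem IsLexShortestPath.reverse {a b : V} {p : G.Walk a b} (hp : IsLexShortestPath w p) :
    IsLexShortestPath w p.reverse := by
  refine ⟨hp.1.reverse, walkIn_univ _, fun q hq _ hne => ?_⟩
  have := (hp.2.2 q.reverse hq.reverse (walkIn_univ _) ?_).reverse
  · simpa using this
  · rintro rfl
    simp at hne

/-- A lex shortest path weighs no more than any walk with the same endpoints. -/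
theorem IsLexShortestPath.walkWeight_le {a b : V} {p : G.Walk a b}
    (hp : IsLexShortestPath w p) (q : G.Walk a b) : walkWeight w p ≤ walkWeight w q := by
  refine le_trans ?_ (walkWeight_bypass_le w q)
  by_cases h : q.bypass = p
  · rw [h]
  · rcases hp.2.2 _ q.bypass_isPath (walkIn_univ _) h with h | h | h <;> omega

/-- Among the walks of minimum weight, a lex shortest path has the fewest edges. -/
theorem IsLexShortestPath.length_le_bypass {a b : V} {p : G.Walk a b}
    (hp : IsLexShortestPath w p) {q : G.Walk a b} (hq : walkWeight w q ≤ walkWeight w p) :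
    p.length ≤ q.bypass.length := by
  have := walkWeight_bypass_le w q
  by_cases h : q.bypass = p
  · rw [h]
  · rcases hp.2.2 _ q.bypass_isPath (walkIn_univ _) h with h | h | h <;> omega

/-- A lex shortest path between two vertices of a lex shortest path is a part of it. -/
theorem IsLexShortestPath.eq_of_append {u x y v : V} {A : G.Walk u x} {Q p : G.Walk x y}
    {B : G.Walk y v} (hP : IsLexShortestPath w ((A.append Q).append B))
    (hp : IsLexShortestPath w p) : p = Q := by
  by_contra hne
  have hb := hp.2.2 Q hP.1.of_append_left.of_append_right (walkIn_univ _) (Ne.symm hne)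
  have hweight := hP.walkWeight_le ((A.append p).append B)
  have hlength := hP.length_le_bypass (q := (A.append p).append B)
  have hbypass := ((A.append p).append B).length_bypass_le_length
  simp only [walkWeight_append, Walk.length_append] at hweight hlength hbypass
  rcases hb with hb | ⟨h₁, h₂⟩ | ⟨h₁, h₂, h₃⟩
  · omega
  · have := hlength (by omega)
    omega
  · have hW : ((A.append p).append B).IsPath := by
      rw [← Walk.bypass_eq_self_of_length_le_length_bypass ((A.append p).append B)
        (by simp only [Walk.length_append]; have := hlength (by omega); omega)]
      exact Walk.bypass_isPath _
    have hWne : (A.append p).append B ≠ (A.append Q).append B := fun h => by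
      have := congrArg Walk.support h
      simp only [Walk.support_append, List.append_cancel_right_eq,
        List.append_cancel_left_eq] at this
      exact hne (Walk.ext_support (by rw [← p.cons_tail_support, ← Q.cons_tail_support, this]))
    have hsdiff : ∀ {q r : G.Walk x y}, ((A.append q).append B).IsPath →
        ((A.append q).append B).support.toFinset \ ((A.append r).append B).support.toFinset =
          q.support.toFinset \ r.support.toFinset := by
      intro q r hq
      ext t
      have := fun h h' => eq_or_eq_of_isPath_append hq (t := t) h h'
      have hx := r.start_mem_support
      have hy := r.end_mem_support
      simp only [Finset.mem_sdiff, List.mem_toFinset, Walk.mem_support_append_iff]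
      grind
    rcases hP.2.2 _ hW (walkIn_univ _) hWne with h | h | h
    · simp only [walkWeight_append] at h
      omega
    · simp only [Walk.length_append] at h
      omega
    · rw [hsdiff hP.1, hsdiff hW] at h
      exact lt_asymm h.2.2 h₃

/-- A lex shortest path between two vertices of a lex shortest path stays inside it. -/
theorem IsLexShortestPath.support_subset_and_edges_subset {u v x y : V} {P : G.Walk u v}
    (hP : IsLexShortestPath w P) (hx : x ∈ P.support) (hy : y ∈ P.support) {p : G.Walk x y}
    (hp : IsLexShortestPath w p) : p.support ⊆ P.support ∧ p.edges ⊆ P.edges := by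
  obtain ⟨A, B, rfl⟩ := Walk.mem_support_iff_exists_append.mp hx
  rcases (Walk.mem_support_append_iff _ _).mp hy with hy | hy
  · obtain ⟨A, Q, rfl⟩ := Walk.mem_support_iff_exists_append.mp hy
    have h := hP.eq_of_append hp.reverse
    rw [← Walk.reverse_reverse p, h]
    constructor <;> intro t ht <;> simp_all [Walk.mem_support_append_iff]
  · obtain ⟨Q, B, rfl⟩ := Walk.mem_support_iff_exists_append.mp hy
    rw [Walk.append_assoc] at hP
    rw [hP.eq_of_append hp]
    constructor <;> intro t ht <;> simp_all [Walk.mem_support_append_iff]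

end LexShortest

variable [Fintype V] [LinearOrder V]

theorem decomp_lsp_of_mem_support
    (G : SimpleGraph V) (w : Sym2 V → ℕ)
    (hconn : G.Connected) (h2t : IsPartialTwoTree G) (hout : ¬ IsOuterplanar G)
    (u v : V) (huv : u ≠ v) (hsep : IsSeparatorPair G u v)
    (hcomp3 : 3 ≤ numComponentsDel G u v)
    (P : G.Walk u v) (hP : IsLexShortestPath w P)
    (H : Set V) (hH : IsComponentOf G {t | t ≠ u ∧ t ≠ v} H)
    (hHV : ∀ t ∈ P.support, t ∉ H) (hHE : ∀ e ∈ P.edges, e ∉ edgesWithin G H)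
    (G₁ G₂ : G.Subgraph)
    (hV₁ : G₁.verts = decompVerts1 P H) (hE₁ : G₁.edgeSet = decompEdges1 P H)
    (hV₂ : G₂.verts = Hᶜ) (hE₂ : G₂.edgeSet = edgesWithin G Hᶜ) :
    (∀ x ∈ P.support, ∀ y ∈ P.support, ∀ p : G.Walk x y,
      IsLexShortestPath w p → WalkIn G₁.verts G₁.edgeSet p) ∧
    (∀ x ∈ P.support, ∀ y ∈ P.support, ∀ p : G.Walk x y,
      IsLexShortestPath w p → WalkIn G₂.verts G₂.edgeSet p) := by
  have key : ∀ x ∈ P.support, ∀ y ∈ P.support, ∀ p : G.Walk x y, IsLexShortestPath w p →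
      p.support ⊆ P.support ∧ p.edges ⊆ P.edges :=
    fun x hx y hy p hp => hP.support_subset_and_edges_subset hx hy hp
  refine ⟨fun x hx y hy p hp => ?_, fun x hx y hy p hp => ?_⟩ <;>
    obtain ⟨hsupp, hedges⟩ := key x hx y hy p hp
  · rw [hV₁, hE₁]
    exact ⟨fun t ht => Or.inr (hsupp ht), fun e he => Or.inl (Or.inr (hedges he))⟩
  · rw [hV₂, hE₂]
    exact ⟨fun t ht => hHV t (hsupp ht), fun e he => ⟨p.edges_subset_edgeSet he,
      fun t ht => hHV t (hsupp (p.mem_support_of_mem_edges he ht))⟩⟩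

end LexMCB
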